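/- Let β₁, β₂, … be an admissible enumeration of ℚ/ℤ. If β_l and β_m are distinct nonzero points in ℚ/ℤ such that β_m is contained in the open interval I(β_l′, β_l″), then l < m. -/

import Mathlib

open MeasureTheory Filter Set

noncomputable section

/-- The normalized sawtooth function `ψ(x) = x - ⌊x⌋ - 1/2` for non-integer `x`,
and `ψ(x) = 0` for integer `x`.  It is periodic with period 1. -/
def saw (x : ℝ) : ℝ := if Int.fract x = 0 then 0 else Int.fract x - 1/2

/-- For a rational `β = a/q` in lowest terms, the denominator `q'` of the left Farey
neighbour of `β` in the Farey fractions of order `q`:  the unique `q' ∈ {1, …, q-1}` with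
`a * q' ≡ 1 (mod q)`. -/
def lden (β : ℚ) : ℕ := ((β.num : ZMod β.den)⁻¹).val

/-- The denominator `q''` of the right Farey neighbour of `β`:  the unique
`q'' ∈ {1, …, q-1}` with `a * q'' ≡ -1 (mod q)`. -/
def rden (β : ℚ) : ℕ := (((-β.num : ℤ) : ZMod β.den)⁻¹).val

/-- The left Farey neighbour `β'` of `β`:  the unique point of `F_{h(β)}` such that
`{β', β}` are consecutive in `F_{h(β)}`.  Explicitly `β' = (a q' - 1)/(q q') = a'/q'`. -/
def lpt (β : ℚ) : ℚ := ((β.num * (lden β : ℤ) - 1 : ℤ) : ℚ) / ((β.den * lden β : ℕ) : ℚ)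

/-- The right Farey neighbour `β''` of `β`:  the unique point of `F_{h(β)}` such that
`{β, β''}` are consecutive in `F_{h(β)}`.  Explicitly `β'' = (a q'' + 1)/(q q'') = a''/q''`.
(For `β ∈ (0,1)` one has `β' ∈ [0,β)` and `β'' ∈ (β,1]`; the rational `1` represents
the zero coset of `ℚ/ℤ`.) -/
def rpt (β : ℚ) : ℚ := ((β.num * (rden β : ℤ) + 1 : ℤ) : ℚ) / ((β.den * rden β : ℕ) : ℚ)

/-- The function `f_β : ℝ/ℤ → ℝ` (realized as a 1-periodic function on `ℝ`), where
`β` ranges over rationals in `[0,1)` (representatives of `ℚ/ℤ`):  `f_0 ≡ 1` and, for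
`β ≠ 0`, `f_β(x) = h(β) ψ(x-β) - h(β') ψ(x-β') - h(β'') ψ(x-β'')`, the height `h` of a
rational being its reduced denominator. -/
def fb (β : ℚ) (x : ℝ) : ℝ :=
  if β = 0 then 1 else
    (β.den : ℝ) * saw (x - (β : ℝ)) - ((lpt β).den : ℝ) * saw (x - ((lpt β : ℚ) : ℝ))
      - ((rpt β).den : ℝ) * saw (x - ((rpt β : ℚ) : ℝ))

/-- The Farey fractions of order `Q` in `[0,1]` (both `0` and `1` represent the zero
coset of `ℚ/ℤ`). -/
def fareySet (Q : ℕ) : Set ℚ := {γ | 0 ≤ γ ∧ γ ≤ 1 ∧ γ.den ≤ Q}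

/-- `{γ₁, γ₂}` are consecutive points of `F_Q`, i.e. `I(γ₁,γ₂) = (γ₁,γ₂)` is a component
interval of `(ℝ/ℤ) ∖ F_Q`. -/
def consec (Q : ℕ) (γ₁ γ₂ : ℚ) : Prop :=
  γ₁ ∈ fareySet Q ∧ γ₂ ∈ fareySet Q ∧ γ₁ < γ₂ ∧ ∀ γ ∈ fareySet Q, γ ≤ γ₁ ∨ γ₂ ≤ γ

/-- The finite set `F_Q = {β ∈ ℚ/ℤ : h(β) ≤ Q}`, realized as the rationals in `[0,1)`
with denominator at most `Q`. -/
def fareyFin (Q : ℕ) : Finset ℚ :=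
  ((Finset.range (Q+1) ×ˢ Finset.range (Q+1)).image fun p => (p.1 : ℚ) / (p.2 : ℚ)).filter
    fun β => 0 ≤ β ∧ β < 1 ∧ β.den ≤ Q

/-- The Gauss map `x ↦ {1/x}`. -/
def gaussMap (x : ℝ) : ℝ := Int.fract x⁻¹

/-- `cfa α n` is the `n`-th partial quotient `a_n` of the continued fraction expansion
`α = [0; a₁, a₂, …]` of `α ∈ (0,1)` (with the convention `a₀ = 0`). -/
def cfa (α : ℝ) : ℕ → ℤ
  | 0 => 0
  | n+1 => ⌊(gaussMap^[n] α)⁻¹⌋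

/-- `cfpq α (n+2) = (pₙ, qₙ)`, the numerators and denominators of the principal
convergents of `α`:  `p₋₂ = 0, q₋₂ = 1, p₋₁ = 1, q₋₁ = 0`,
`pₙ = aₙ pₙ₋₁ + pₙ₋₂`, `qₙ = aₙ qₙ₋₁ + qₙ₋₂`. -/
def cfpq (α : ℝ) : ℕ → ℤ × ℤ
  | 0 => (0, 1)
  | 1 => (1, 0)
  | n+2 => (cfa α n * (cfpq α (n+1)).1 + (cfpq α n).1,
            cfa α n * (cfpq α (n+1)).2 + (cfpq α n).2)

/-- The element `(m pₙ₋₁ + pₙ₋₂)/(m qₙ₋₁ + qₙ₋₂)` of `E_n(α)`, reduced modulo 1 to the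
representative in `[0,1)` of its coset in `ℚ/ℤ`. -/
def cfE (α : ℝ) (n : ℕ) (m : ℤ) : ℚ :=
  Int.fract (((m * (cfpq α (n+1)).1 + (cfpq α n).1 : ℤ) : ℚ) /
             ((m * (cfpq α (n+1)).2 + (cfpq α n).2 : ℤ) : ℚ))

/-- `E_n(α) = {(m pₙ₋₁ + pₙ₋₂)/(m qₙ₋₁ + qₙ₋₂) : 1 ≤ m ≤ aₙ}`, the set of the `n`-th
principal convergent together with the intermediate convergents, as a finite set of
representatives in `[0,1)` of elements of `ℚ/ℤ`. -/
def cfEfin (α : ℝ) (n : ℕ) : Finset ℚ := (Finset.Icc 1 (cfa α n)).image (cfE α n)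


/-- `e` (restricted to indices `n ≥ 1`) is an enumeration `β₁, β₂, …` of `ℚ/ℤ`
(whose elements are realized as the rationals in `[0,1)`). -/
def IsEnumeration (e : ℕ → ℚ) : Prop :=
  (∀ n, 1 ≤ n → e n ∈ Set.Ico (0:ℚ) 1) ∧
  (∀ m n, 1 ≤ m → 1 ≤ n → e m = e n → m = n) ∧
  (∀ β ∈ Set.Ico (0:ℚ) 1, ∃ n, 1 ≤ n ∧ e n = β)

/-- The enumeration `β₁, β₂, …` is admissible: `β₁ = 0`, and for `m ≥ 2`, `β_k = β_m'`
implies `k < m` and `β_l = β_m''` implies `l < m`.  (`Int.fract` reduces the Farey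
neighbours, which lie in `[0,1]`, to their coset representatives in `[0,1)`.) -/
def IsAdmissible (e : ℕ → ℚ) : Prop :=
  e 1 = 0 ∧
  (∀ m, 2 ≤ m → ∀ k, 1 ≤ k → e k = Int.fract (lpt (e m)) → k < m) ∧
  (∀ m, 2 ≤ m → ∀ l, 1 ≤ l → e l = Int.fract (rpt (e m)) → l < m)

theorem lpt_eq_div {β : ℚ} (h : 1 < β.den) :
    ∃ c : ℤ, 0 < lden β ∧ lden β < β.den ∧ β.num * lden β = c * β.den + 1 ∧
      lpt β = c / lden β := by
  have : NeZero β.den := ⟨by omega⟩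
  have : Fact (1 < β.den) := ⟨h⟩
  have hu : IsUnit (β.num : ZMod β.den) := by
    rw [ZMod.coe_int_isUnit_iff_isCoprime, Int.isCoprime_iff_gcd_eq_one]
    have := β.reduced
    rw [Nat.coprime_comm] at this
    simpa [Int.gcd] using this
  have hmul : (β.num : ZMod β.den) * (lden β : ZMod β.den) = 1 := by
    rw [lden, ZMod.natCast_zmod_val]
    exact ZMod.mul_inv_of_unit _ hu
  have hpos : 0 < lden β := by
    rcases Nat.eq_zero_or_pos (lden β) with h0 | h0
    · simp [h0] at hmul
    · exact h0
  have hdvd : (β.den : ℤ) ∣ β.num * lden β - 1 := by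
    rw [← ZMod.intCast_zmod_eq_zero_iff_dvd]
    push_cast
    rw [hmul, sub_self]
  obtain ⟨c, hc⟩ := hdvd
  refine ⟨c, hpos, ZMod.val_lt _, by linarith, ?_⟩
  have hd : (β.den : ℚ) ≠ 0 := by exact_mod_cast β.den_nz
  have hl : (lden β : ℚ) ≠ 0 := by exact_mod_cast hpos.ne'
  rw [lpt, hc]
  push_cast
  field_simp

theorem lpt_lt {β : ℚ} (h : 1 < β.den) : lpt β < β := by
  obtain ⟨c, hpos, -, hc, heq⟩ := lpt_eq_div h
  rw [heq]
  nth_rw 2 [← Rat.num_div_den β]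
  rw [div_lt_div_iff₀ (by exact_mod_cast hpos) (by exact_mod_cast β.pos)]
  exact_mod_cast (by linarith : c * (β.den : ℤ) < β.num * lden β)

theorem den_lpt_lt {β : ℚ} (h : 1 < β.den) : (lpt β).den < β.den := by
  obtain ⟨c, hpos, hlt, -, heq⟩ := lpt_eq_div h
  have hdvd : ((lpt β).den : ℤ) ∣ lden β := by
    rw [heq]
    exact_mod_cast Rat.den_dvd c (lden β)
  exact (Nat.le_of_dvd hpos (by exact_mod_cast hdvd)).trans_lt hlt

theorem den_lt_of_lpt_lt_of_lt {β x : ℚ} (h : 1 < β.den) (h₁ : lpt β < x) (h₂ : x < β) :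
    β.den < x.den := by
  obtain ⟨c, hpos, -, hc, heq⟩ := lpt_eq_div h
  rw [heq, ← Rat.num_div_den x,
    div_lt_div_iff₀ (by exact_mod_cast hpos) (by exact_mod_cast x.pos)] at h₁
  rw [Rat.lt_iff] at h₂
  have h₁' : c * (x.den : ℤ) < x.num * lden β := by exact_mod_cast h₁
  have hd : (0 : ℤ) < β.den := by exact_mod_cast β.pos
  have hl : (0 : ℤ) < lden β := by exact_mod_cast hpos
  have key : (x.den : ℤ) = lden β * (β.num * x.den - x.num * β.den)
      + β.den * (x.num * lden β - c * x.den) := by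
    linear_combination (-(x.den : ℤ)) * hc
  have : (β.den : ℤ) < x.den := by nlinarith
  exact_mod_cast this

theorem rpt_eq_neg_lpt_neg (β : ℚ) : rpt β = -lpt (-β) := by
  have hden : rden β = lden (-β) := rfl
  rw [rpt, lpt, hden, Rat.neg_num, Rat.neg_den, ← neg_div]
  congr 1
  push_cast
  ring

theorem lt_rpt {β : ℚ} (h : 1 < β.den) : β < rpt β := by
  rw [rpt_eq_neg_lpt_neg]
  exact lt_neg_of_lt_neg (lpt_lt (β := -β) h)

theorem den_rpt_lt {β : ℚ} (h : 1 < β.den) : (rpt β).den < β.den := by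
  rw [rpt_eq_neg_lpt_neg]
  exact den_lpt_lt (β := -β) h

theorem den_lt_of_lt_of_lt_rpt {β x : ℚ} (h : 1 < β.den) (h₁ : β < x) (h₂ : x < rpt β) :
    β.den < x.den := by
  rw [rpt_eq_neg_lpt_neg] at h₂
  exact den_lt_of_lpt_lt_of_lt (β := -β) (x := -x) h (lt_neg_of_lt_neg h₂) (neg_lt_neg h₁)

theorem one_lt_den_of_mem_Ioo {x : ℚ} (h₀ : 0 < x) (h₁ : x < 1) : 1 < x.den := by
  by_contra hle
  have hd : x.den = 1 := le_antisymm (not_lt.mp hle) x.pos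
  rw [← Rat.num_div_den x, hd] at h₀ h₁
  have h₀' : 0 < x.num := by simpa using h₀
  have h₁' : x.num < 1 := by
    have : (x.num : ℚ) < 1 := by simpa using h₁
    exact_mod_cast this
  omega

/-- **Lemma 7 (Haynes–Vaaler).**  Let `β₁, β₂, …` be an admissible enumeration of `ℚ/ℤ`.
If `β_l` and `β_m` are distinct nonzero points of `ℚ/ℤ` such that `β_m` lies in the open
interval `I(β_l', β_l'')`, then `l < m`. -/
theorem admissible_lt_of_mem_interval (e : ℕ → ℚ) (he : IsEnumeration e)
    (hadm : IsAdmissible e) (l m : ℕ) (hl : 1 ≤ l) (hm : 1 ≤ m)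
    (hl0 : e l ≠ 0) (hm0 : e m ≠ 0) (hne : e l ≠ e m)
    (hmem : ((e m : ℚ) : ℝ) ∈ Set.Ioo ((lpt (e l) : ℚ) : ℝ) ((rpt (e l) : ℚ) : ℝ)) :
    l < m := by
  have hmem' : e m ∈ Set.Ioo (lpt (e l)) (rpt (e l)) := by
    simpa [Set.mem_Ioo] using hmem
  clear hmem
  obtain ⟨hran, -, hsurj⟩ := he
  obtain ⟨he1, hleft, hright⟩ := hadm
  have hlpos : 0 < e l := lt_of_le_of_ne (hran l hl).1 hl0.symm
  have hl1 : 1 < (e l).den := one_lt_den_of_mem_Ioo hlpos (hran l hl).2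
  induction hn : (e m).den using Nat.strong_induction_on generalizing m with
  | _ n ih =>
    subst hn
    have hmpos : 0 < e m := lt_of_le_of_ne (hran m hm).1 hm0.symm
    have hm1 : 1 < (e m).den := one_lt_den_of_mem_Ioo hmpos (hran m hm).2
    have hm2 : 2 ≤ m := by
      rcases hm.eq_or_lt with rfl | h
      · exact absurd he1 hm0
      · exact h
    rcases hne.lt_or_gt with hlt | hgt
    · have hden := den_lt_of_lt_of_lt_rpt hl1 hlt hmem'.2
      have hle : e l ≤ lpt (e m) := by
        by_contra! h
        exact hden.not_gt (den_lt_of_lpt_lt_of_lt hm1 h hlt)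
      have hltm := lpt_lt hm1
      have hIco : lpt (e m) ∈ Set.Ico (0 : ℚ) 1 :=
        ⟨hlpos.le.trans hle, hltm.trans (hran m hm).2⟩
      have hfract : Int.fract (lpt (e m)) = lpt (e m) := Int.fract_eq_self.mpr hIco
      rcases hle.eq_or_lt with heq | hlt'
      · exact hleft m hm2 l hl (by rw [hfract, heq])
      · obtain ⟨k, hk, hek⟩ := hsurj _ hIco
        have hkm := hleft m hm2 k hk (by rw [hfract, hek])
        rw [← hek] at hlt' hltm
        exact (ih _ (hek ▸ den_lpt_lt hm1) k hk (hlpos.trans hlt').ne' hlt'.ne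
          ⟨(lpt_lt hl1).trans hlt', hltm.trans hmem'.2⟩ rfl).trans hkm
    · have hden := den_lt_of_lpt_lt_of_lt hl1 hmem'.1 hgt
      have hle : rpt (e m) ≤ e l := by
        by_contra! h
        exact hden.not_gt (den_lt_of_lt_of_lt_rpt hm1 hgt h)
      have hltm := lt_rpt hm1
      have hIco : rpt (e m) ∈ Set.Ico (0 : ℚ) 1 :=
        ⟨(hmpos.trans hltm).le, hle.trans_lt (hran l hl).2⟩
      have hfract : Int.fract (rpt (e m)) = rpt (e m) := Int.fract_eq_self.mpr hIco
      rcases hle.eq_or_lt with heq | hlt'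
      · exact hright m hm2 l hl (by rw [hfract, heq])
      · obtain ⟨k, hk, hek⟩ := hsurj _ hIco
        have hkm := hright m hm2 k hk (by rw [hfract, hek])
        rw [← hek] at hlt' hltm
        exact (ih _ (hek ▸ den_rpt_lt hm1) k hk (hmpos.trans hltm).ne' hlt'.ne'
          ⟨hmem'.1.trans hltm, hlt'.trans (lt_rpt hl1)⟩ rfl).trans hkm

end
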